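/- arXiv:2507.21927 — 2 statements merged into one kernel-verified Lean document; each statement's English description precedes it below -/
import Mathlib

section
/- Let α₁,…,α_m ∈ ℂ* and s₁,…,s_m ∈ ℤ_{≥1} with s₁+⋯+s_m = s. For n ∈ ℤ, 1 ≤ t ≤ m, and s₁+⋯+s_{t-1}+1 ≤ k ≤ s₁+⋯+s_t, define f_k(n) = n^{k-1-Σ_{j<t}s_j} α_t^n. Let R = (y_{pq}) be the s×s matrix with y_{pq} = f_q(p-1) for q = 1,…,s and p = r+1,…,r+s (some r ≥ 0). Then det R = ∏_{j=1}^m (s_j-1)^{!!} α_j^{s_j(s_j+2r-1)/2} ∏_{1≤i<j≤m} (α_j - α_i)^{s_i s_j}, where m^{!!} = m!·(m-1)!·⋯·1! and 0^{!!} = 1. -/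
/- STATEMENT 17: the generalized (confluent) Vandermonde determinant of
[TZ, Lemma 2].  Columns `q = 1, …, s` of the `s × s` matrix come in blocks: the
`t`-th block has size `s_t` and its columns are the functions
`n ↦ n^{k-1-Σ_{j<t} s_j} α_t^n`.  Rows are indexed by `n = r, r+1, …, r+s-1`
(i.e. `p = r+1, …, r+s` with entry `f_q(p-1)`).  We encode the block structure
by a function `blk : Fin s → Fin m` assigning to each column its block, subject
to the defining inequalities, so that the offset of column `q` within its block
is `q - Σ_{i < blk q} s_i`. -/

/-- superfactorial: `n^{!!} = n! ⬝ (n-1)! ⬝ ⋯ ⬝ 1!`, with `0^{!!} = 1`. -/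
def superFactorial : ℕ → ℕ
  | 0 => 1
  | n + 1 => Nat.factorial (n + 1) * superFactorial n

open Finset

section EulerOperator

open Polynomial

variable {R : Type*} [CommRing R]

/-- The Euler operator `f ↦ X * derivative f` on polynomials. -/
noncomputable def eulerOperator : R[X] →ₗ[R] R[X] :=
  LinearMap.mulLeft R X ∘ₗ derivative

theorem eulerOperator_apply (f : R[X]) : eulerOperator f = X * derivative f := rfl

theorem eulerOperator_pow_X_pow (j n : ℕ) :
    (eulerOperator ^ j) (X ^ n : R[X]) = C ((n : R) ^ j) * X ^ n := by
  induction j with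
  | zero => simp
  | succ j ih =>
    rw [pow_succ', Module.End.mul_apply, ih, eulerOperator_apply, derivative_C_mul_X_pow]
    cases n with
    | zero => simp
    | succ n =>
      simp only [Nat.add_sub_cancel, pow_succ, C_mul]
      ring

/-- Applying the Euler operator `j ≤ k` times to `(X - a) ^ k * g` leaves the factor
`(X - a) ^ (k - j)`, and the cofactor has a known value at `a`. -/
theorem exists_eulerOperator_pow_X_sub_C_pow_mul (a : R) (g : R[X]) {j k : ℕ} (hjk : j ≤ k) :
    ∃ h : R[X], (eulerOperator ^ j) ((X - C a) ^ k * g) = (X - C a) ^ (k - j) * h ∧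
      h.eval a = k.descFactorial j * a ^ j * g.eval a := by
  induction j with
  | zero => exact ⟨g, by simp, by simp⟩
  | succ j ih =>
    obtain ⟨h, hh, hev⟩ := ih (by omega)
    obtain ⟨d, rfl⟩ : ∃ d, k = j + 1 + d := ⟨k - (j + 1), by omega⟩
    have h1 : j + 1 + d - j = d + 1 := by omega
    have h2 : j + 1 + d - (j + 1) = d := by omega
    refine ⟨X * (C ((d : R) + 1) * h + (X - C a) * derivative h), ?_, ?_⟩
    · rw [pow_succ', Module.End.mul_apply, hh, h1, h2, eulerOperator_apply, derivative_mul,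
        derivative_X_sub_C_pow]
      simp
      ring
    · rw [Nat.descFactorial_succ, h1]
      simp [hev]
      ring

theorem eval_eulerOperator_pow_of_lt (a : R) (g : R[X]) {j k : ℕ} (hjk : j < k) :
    ((eulerOperator ^ j) ((X - C a) ^ k * g)).eval a = 0 := by
  obtain ⟨h, hh, -⟩ := exists_eulerOperator_pow_X_sub_C_pow_mul a g hjk.le
  rw [hh]
  simp [Nat.sub_ne_zero_of_lt hjk]

theorem eval_eulerOperator_pow_self (a : R) (g : R[X]) (k : ℕ) :
    ((eulerOperator ^ k) ((X - C a) ^ k * g)).eval a = k.factorial * a ^ k * g.eval a := by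
  obtain ⟨h, hh, hev⟩ := exists_eulerOperator_pow_X_sub_C_pow_mul a g le_rfl
  rw [hh]
  simp [hev, Nat.descFactorial_self]

/-- A matrix of linear functionals evaluated on `X ^ r, X ^ (r + 1), …` has the same determinant
as on `X ^ r * N p` for monic `N p` of degree `p`. -/
theorem det_linearMap_X_pow_mul {n : ℕ} (r : ℕ) (L : Fin n → R[X] →ₗ[R] R) (N : Fin n → R[X])
    (hdeg : ∀ p, (N p).natDegree = p) (hmonic : ∀ p, (N p).Monic) :
    Matrix.det (Matrix.of fun p q : Fin n => L q (X ^ (r + (p : ℕ)))) =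
      Matrix.det (Matrix.of fun p q : Fin n => L q (X ^ r * N p)) := by
  have hC : (Matrix.of fun i j : Fin n => (N j).coeff i).transpose.det = 1 := by
    rw [Matrix.det_transpose, Matrix.det_matrixOfPolynomials N hdeg hmonic]
  rw [← one_mul (Matrix.det _), ← hC, ← Matrix.det_mul]
  congr 1
  ext p q
  have hN : N p = ∑ i : Fin n, C ((N p).coeff i) * X ^ (i : ℕ) := by
    rw [Fin.sum_univ_eq_sum_range (fun i => C ((N p).coeff i) * X ^ i)]
    exact (N p).as_sum_range_C_mul_X_pow' (by rw [hdeg]; exact p.isLt)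
  conv_rhs => rw [Matrix.of_apply, hN]
  simp only [Matrix.mul_apply, Matrix.transpose_apply, Matrix.of_apply, Finset.mul_sum, map_sum]
  refine Finset.sum_congr rfl fun i _ => ?_
  rw [← smul_eq_mul, ← map_smul, smul_eq_C_mul, pow_add]
  congr 1
  ring

end EulerOperator

section Blocks

variable {m S : ℕ} {s : Fin m → ℕ} {blk : Fin S → Fin m}

theorem sum_Iic_le_sum_Iio (s : Fin m → ℕ) {t u : Fin m} (h : t < u) :
    ∑ i ∈ Iic t, s i ≤ ∑ i ∈ Iio u, s i :=
  sum_le_sum_of_subset fun i hi => by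
    rw [mem_Iic] at hi
    exact mem_Iio.2 (hi.trans_lt h)

theorem sum_Iic_eq_sum_Iio_add (s : Fin m → ℕ) (t : Fin m) :
    ∑ i ∈ Iic t, s i = ∑ i ∈ Iio t, s i + s t := by
  rw [← Iio_insert, sum_insert (by simp), add_comm]

theorem monotone_blk (hblk : ∀ q : Fin S,
    (∑ i ∈ Iio (blk q), s i) ≤ (q : ℕ) ∧ (q : ℕ) < ∑ i ∈ Iic (blk q), s i) :
    Monotone blk := by
  intro p q hpq
  by_contra! h
  have h1 := sum_Iic_le_sum_Iio s h
  have h2 := (hblk p).1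
  have h3 := (hblk q).2
  have h4 : (p : ℕ) ≤ q := hpq
  omega

theorem prod_blk {M : Type*} [CommMonoid M] (hS : ∑ j, s j = S) (hblk : ∀ q : Fin S,
    (∑ i ∈ Iio (blk q), s i) ≤ (q : ℕ) ∧ (q : ℕ) < ∑ i ∈ Iic (blk q), s i)
    (f : Fin m → ℕ → M) :
    ∏ q, f (blk q) ((q : ℕ) - ∑ i ∈ Iio (blk q), s i) = ∏ t, ∏ j ∈ range (s t), f t j := by
  let e : Fin S → (t : Fin m) × Fin (s t) := fun q =>
    ⟨blk q, (q : ℕ) - ∑ i ∈ Iio (blk q), s i, by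
      have h1 := hblk q
      have h2 := sum_Iic_eq_sum_Iio_add s (blk q)
      omega⟩
  have he : Function.Bijective e := by
    refine (Fintype.bijective_iff_injective_and_card e).2 ⟨fun p q hpq => ?_, by simp [hS]⟩
    have h1 : blk p = blk q := congrArg Sigma.fst hpq
    have h2 : (p : ℕ) - ∑ i ∈ Iio (blk p), s i = q - ∑ i ∈ Iio (blk q), s i :=
      congrArg (fun x : (t : Fin m) × Fin (s t) => (x.2 : ℕ)) hpq
    have h3 := (hblk p).1
    have h4 := (hblk q).1
    rw [h1] at h2 h3
    exact Fin.ext (by omega)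
  simp_rw [← Fin.prod_univ_eq_prod_range]
  rw [← Fintype.prod_sigma' (fun t (j : Fin (s t)) => f t j)]
  exact Fintype.prod_bijective e he _ _ fun _ => rfl

theorem prod_filter_blk_lt {M : Type*} [CommMonoid M] (hS : ∑ j, s j = S) (hblk : ∀ q : Fin S,
    (∑ i ∈ Iio (blk q), s i) ≤ (q : ℕ) ∧ (q : ℕ) < ∑ i ∈ Iic (blk q), s i)
    (t : Fin m) (f : Fin m → M) :
    ∏ q with blk q < t, f (blk q) = ∏ i ∈ Iio t, f i ^ s i := by
  rw [prod_filter, prod_blk hS hblk fun u _ => if u < t then f u else 1]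
  simp [prod_ite, filter_gt_eq_Iio]

theorem prod_Iio_blk {M : Type*} [CommMonoid M] (hS : ∑ j, s j = S) (hblk : ∀ q : Fin S,
    (∑ i ∈ Iio (blk q), s i) ≤ (q : ℕ) ∧ (q : ℕ) < ∑ i ∈ Iic (blk q), s i)
    (q : Fin S) (f : Fin m → M) :
    ∏ p ∈ Iio q, f (blk p) =
      f (blk q) ^ ((q : ℕ) - ∑ i ∈ Iio (blk q), s i) * ∏ i ∈ Iio (blk q), f i ^ s i := by
  have hmono := monotone_blk hblk
  have hlt : {p ∈ Iio q | blk p < blk q} = ({p | blk p < blk q} : Finset (Fin S)) := by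
    ext p
    simpa using fun h => hmono.reflect_lt h
  have heq : {p ∈ Iio q | ¬ blk p < blk q} =
      Ico ⟨∑ i ∈ Iio (blk q), s i, (hblk q).1.trans_lt q.isLt⟩ q := by
    ext p
    simp only [mem_filter, mem_Iio, mem_Ico, Fin.le_def, and_comm (b := p < q)]
    refine and_congr_right fun hpq => ⟨fun h => ?_, fun h hlt => ?_⟩
    · rw [← (hmono hpq.le).antisymm (not_lt.1 h)]
      exact (hblk p).1
    · have h1 := sum_Iic_le_sum_Iio s hlt
      have h2 := (hblk p).2
      have h3 : ∑ i ∈ Iio (blk q), s i ≤ (p : ℕ) := h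
      omega
  rw [← prod_filter_mul_prod_filter_not _ (fun p => blk p < blk q), hlt,
    prod_filter_blk_lt hS hblk, mul_comm]
  congr 1
  rw [prod_eq_pow_card (b := f (blk q)), heq, Fin.card_Ico]
  intro p hp
  rw [mem_filter, mem_Iio] at hp
  rw [(hmono hp.1.le).antisymm (not_lt.1 hp.2)]

end Blocks

theorem prod_range_factorial_eq_superFactorial (n : ℕ) :
    ∏ j ∈ range (n + 1), j.factorial = superFactorial n := by
  induction n with
  | zero => rfl
  | succ n ih => rw [prod_range_succ, ih, mul_comm, superFactorial]

theorem prod_range_factorial_mul_pow {R : Type*} [CommSemiring R] (a : R) (r : ℕ) {n : ℕ}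
    (hn : 1 ≤ n) :
    ∏ j ∈ range n, ((j.factorial : R) * a ^ j * a ^ r) =
      superFactorial (n - 1) * a ^ ((n * (n + 2 * r - 1)) / 2) := by
  obtain ⟨n, rfl⟩ := Nat.exists_eq_add_of_le' hn
  have hexp : (n + 1) * (n + 1 + 2 * r - 1) / 2 = ∑ j ∈ range (n + 1), j + r * (n + 1) := by
    refine Nat.div_eq_of_eq_mul_left two_pos ?_
    rw [add_mul (∑ j ∈ range (n + 1), j), sum_range_id_mul_two,
      show n + 1 + 2 * r - 1 = n + 2 * r by omega,
      Nat.add_sub_cancel]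
    ring
  rw [prod_mul_distrib, prod_mul_distrib, prod_pow_eq_pow_sum, hexp, pow_add, pow_mul,
    Nat.add_sub_cancel, ← prod_range_factorial_eq_superFactorial]
  simp only [prod_const, card_range, Nat.cast_prod, mul_assoc]

theorem generalized_vandermonde_det
    (m : ℕ) (α : Fin m → ℂ) (hα : ∀ j, α j ≠ 0)
    (s : Fin m → ℕ) (hs : ∀ j, 1 ≤ s j)
    (S : ℕ) (hS : ∑ j, s j = S) (r : ℕ)
    (blk : Fin S → Fin m)
    (hblk : ∀ q : Fin S,
      (∑ i ∈ Finset.Iio (blk q), s i) ≤ (q : ℕ) ∧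
        (q : ℕ) < ∑ i ∈ Finset.Iic (blk q), s i) :
    Matrix.det (Matrix.of fun p q : Fin S =>
        ((r + (p : ℕ) : ℕ) : ℂ) ^ ((q : ℕ) - ∑ i ∈ Finset.Iio (blk q), s i)
          * (α (blk q)) ^ (r + (p : ℕ)))
      = (∏ j, (superFactorial (s j - 1) : ℂ)
            * (α j) ^ ((s j * (s j + 2 * r - 1)) / 2))
        * ∏ j, ∏ i ∈ Finset.Iio j, (α j - α i) ^ (s i * s j) := by
  let off : Fin S → ℕ := fun q => (q : ℕ) - ∑ i ∈ Iio (blk q), s i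
  let N : Fin S → Polynomial ℂ := fun p =>
    ∏ i ∈ Iio p, (Polynomial.X - Polynomial.C (α (blk i)))
  let L : Fin S → Polynomial ℂ →ₗ[ℂ] ℂ := fun q =>
    Polynomial.leval (α (blk q)) ∘ₗ (eulerOperator ^ off q)
  have hmonic (p) : (N p).Monic :=
    Polynomial.monic_prod_of_monic _ _ fun _ _ => Polynomial.monic_X_sub_C _
  have hdeg (p) : (N p).natDegree = p := by
    rw [Polynomial.natDegree_prod_of_monic _ _ fun _ _ => Polynomial.monic_X_sub_C _]
    simp
  have hN (q) : N q = (Polynomial.X - Polynomial.C (α (blk q))) ^ off q *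
      ∏ i ∈ Iio (blk q), (Polynomial.X - Polynomial.C (α i)) ^ s i :=
    prod_Iio_blk hS hblk q fun t => Polynomial.X - Polynomial.C (α t)
  have hM : (Matrix.of fun p q : Fin S =>
      ((r + (p : ℕ) : ℕ) : ℂ) ^ ((q : ℕ) - ∑ i ∈ Finset.Iio (blk q), s i)
        * (α (blk q)) ^ (r + (p : ℕ))) =
      Matrix.of fun p q : Fin S => L q (Polynomial.X ^ (r + (p : ℕ))) := by
    ext p q
    simp only [Matrix.of_apply, L, LinearMap.comp_apply, eulerOperator_pow_X_pow,
      Polynomial.leval_apply, Polynomial.eval_mul, Polynomial.eval_C, Polynomial.eval_pow,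
      Polynomial.eval_X, off]
  have htri : (Matrix.of fun p q : Fin S =>
      L q (Polynomial.X ^ r * N p)).IsUpperTriangular := by
    intro p q hqp
    have hdvd : (Polynomial.X - Polynomial.C (α (blk q))) ^ (off q + 1) ∣ N p := by
      refine dvd_trans ?_ (prod_dvd_prod_of_subset (Iic q) (Iio p) _ fun i hi =>
        mem_Iio.2 ((mem_Iic.1 hi).trans_lt hqp))
      rw [← Iio_insert, prod_insert (by simp), pow_succ']
      exact mul_dvd_mul_left _ (Dvd.intro _ (hN q).symm)
    obtain ⟨g, hg⟩ := hdvd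
    rw [Matrix.of_apply, hg, mul_left_comm]
    exact eval_eulerOperator_pow_of_lt _ _ (Nat.lt_succ_self _)
  have hdiag (q) : L q (Polynomial.X ^ r * N q) =
      ((off q).factorial : ℂ) * α (blk q) ^ off q * α (blk q) ^ r *
        ∏ i ∈ Iio (blk q), (α (blk q) - α i) ^ s i := by
    rw [hN, mul_left_comm]
    refine (eval_eulerOperator_pow_self _ _ _).trans ?_
    simp [Polynomial.eval_prod, mul_assoc]
  rw [hM, det_linearMap_X_pow_mul r L N hdeg hmonic, Matrix.det_of_isUpperTriangular htri]
  simp only [Matrix.of_apply, hdiag]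
  rw [prod_blk hS hblk fun t j => (j.factorial : ℂ) * α t ^ j * α t ^ r *
    ∏ i ∈ Iio t, (α t - α i) ^ s i, ← prod_mul_distrib]
  refine prod_congr rfl fun t _ => ?_
  rw [prod_mul_distrib, prod_range_factorial_mul_pow _ _ (hs t), prod_const, card_range,
    ← prod_pow]
  simp only [pow_mul]
end

section
/- The tensor product T = ⊗_{k=1}^m Ω(α_k,β_k,γ_k,λ_k,g_k) of the rank-1 U(B)-free simple modules is a simple U(L)-module if and only if λ₁,…,λ_m are pairwise distinct. In particular, if λ₁ = λ₂, the subspace W = span{ℂ[t₁,t₂](s₁+s₂)^p : p ∈ ℕ} ⊗ ℂ[s₃,t₃] ⊗ ⋯ is a proper nonzero submodule. -/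
/- STATEMENT 18: the tensor product `T = ⊗_{k=1}^m Ω(α_k,β_k,γ_k,λ_k,g_k)` is a simple `U(L)`-module if and only if `λ₁,…,λ_m` are pairwise distinct. -/
noncomputable section

open MvPolynomial

/-- the tensor product `⊗_{k=1}^m ℂ[s_k, t_k]`, realized as the polynomial
ring in the variables `s_k = X (Sum.inl k)`, `t_k = X (Sum.inr k)`. -/
abbrev TT (m : ℕ) : Type := MvPolynomial (Fin m ⊕ Fin m) ℂ

/-- substitution `s_k ↦ s_k - n`, all other variables fixed. -/
noncomputable def shf {m : ℕ} (k : Fin m) (n : ℤ) (f : TT m) : TT m :=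
  MvPolynomial.aeval (Function.update (MvPolynomial.X : Fin m ⊕ Fin m → TT m)
    (Sum.inl k) (MvPolynomial.X (Sum.inl k) - MvPolynomial.C (n : ℂ))) f

/-- `g_k(t_k)` as an element of the big polynomial ring. -/
noncomputable def gT {m : ℕ} (g : Fin m → Polynomial ℂ) (k : Fin m) : TT m :=
  Polynomial.aeval (MvPolynomial.X (Sum.inr k) : TT m) (g k)

variable {m : ℕ}

/-- diagonal action of `L_n`. -/
noncomputable def tL (α lam : Fin m → ℂ) (n : ℤ) (f : TT m) : TT m :=
  ∑ k : Fin m, (lam k ^ n) •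
    ((MvPolynomial.X (Sum.inl k) + MvPolynomial.C ((n : ℂ) * α k)) * shf k n f)

/-- diagonal action of `d_n`. -/
noncomputable def tD (β γ lam : Fin m → ℂ) (g : Fin m → Polynomial ℂ) (n : ℤ) (f : TT m) :
    TT m :=
  ∑ k : Fin m,
    ((lam k ^ n * (β k)⁻¹) •
        ((MvPolynomial.X (Sum.inr k) * gT g k + MvPolynomial.C (γ k)) * shf k n f)
      + (lam k ^ n) •
        (MvPolynomial.X (Sum.inr k) * MvPolynomial.pderiv (Sum.inr k) (shf k n f)))

/-- diagonal action of `a_n`. -/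
noncomputable def tA (lam : Fin m → ℂ) (n : ℤ) (f : TT m) : TT m :=
  ∑ k : Fin m, (lam k ^ n) • (MvPolynomial.X (Sum.inr k) * shf k n f)

/-- diagonal action of `b_n`. -/
noncomputable def tB (β lam : Fin m → ℂ) (g : Fin m → Polynomial ℂ) (n : ℤ) (f : TT m) :
    TT m :=
  ∑ k : Fin m,
    ((lam k ^ n) • (gT g k * shf k n f)
      + (lam k ^ n * β k) • MvPolynomial.pderiv (Sum.inr k) (shf k n f))

/-- diagonal action of `c_n`. -/
noncomputable def tC (β lam : Fin m → ℂ) (n : ℤ) (f : TT m) : TT m :=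
  ∑ k : Fin m, (-(lam k ^ n) * β k) • shf k n f

section ExponentialPolynomials

variable {K ι : Type*} [Field K]

theorem shift_sub_smul_pow_apply (S : Module.End K (ℕ → K)) (hS : ∀ u n, S u n = u (n + 1))
    (c : K) (P : K → K) (r : ℕ) :
    ((S - c • 1) ^ r) (fun n : ℕ => c ^ n * P n) =
      fun n : ℕ => c ^ (n + r) * ((fwdDiff (1 : K))^[r] P) n := by
  induction r with
  | zero => simp
  | succ r ih =>
    funext n
    rw [pow_succ', Module.End.mul_apply, ih, Function.iterate_succ_apply']
    simp only [LinearMap.sub_apply, LinearMap.smul_apply, Module.End.one_apply, Pi.sub_apply,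
      Pi.smul_apply, hS, smul_eq_mul, fwdDiff]
    push_cast
    ring

variable [CharZero K] [Fintype ι]

/-- The sequences `n ↦ (c k) ^ n * p k n` for distinct nonzero `c k` are independent. -/
theorem eq_zero_of_sum_pow_mul_eval_eq_zero {c : ι → K} (hc : Function.Injective c)
    (hc0 : ∀ k, c k ≠ 0) (p : ι → Polynomial K)
    (h : ∀ n : ℕ, ∑ k, c k ^ n * (p k).eval (n : K) = 0) (k : ι) : p k = 0 := by
  let S : Module.End K (ℕ → K) := LinearMap.funLeft K K (· + 1)
  have hS : ∀ u n, S u n = u (n + 1) := fun _ _ => rfl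
  have hind := (iSupIndep_iff_finsetSum_eq_zero_imp_eq_zero _).1
    (S.independent_maxGenEigenspace.comp hc) Finset.univ
    (fun k n => c k ^ n * (p k).eval (n : K))
    (fun k _ => by
      rw [Function.comp_apply, Module.End.mem_maxGenEigenspace]
      refine ⟨(p k).natDegree + 1, ?_⟩
      rw [shift_sub_smul_pow_apply S hS (c k) (fun x => (p k).eval x),
        (p k).fwdDiff_iter_degree_add_one_eq_zero]
      simp only [Pi.zero_apply, mul_zero]
      rfl)
    (by funext n; simpa using h n) k (Finset.mem_univ k)
  refine Polynomial.eq_zero_of_infinite_isRoot _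
    ((Set.infinite_range_of_injective (Nat.cast_injective (R := K))).mono ?_)
  rintro _ ⟨n, rfl⟩
  exact (mul_eq_zero.1 (congrFun hind n)).resolve_left (pow_ne_zero _ (hc0 k))

theorem coeff_mem_of_sum_pow_smul_eval_mem {A : Type*} [CommRing A] [Algebra K A]
    (N : Submodule K A) {c : ι → K} (hc : Function.Injective c) (hc0 : ∀ k, c k ≠ 0)
    (P : ι → Polynomial A) (h : ∀ n : ℕ, ∑ k, c k ^ n • (P k).eval (n : A) ∈ N)
    (k : ι) (j : ℕ) : (P k).coeff j ∈ N := by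
  by_contra hv
  obtain ⟨φ, hφ, hN⟩ := N.exists_le_ker_of_notMem hv
  let p : ι → Polynomial K := fun k =>
    ∑ j ∈ Finset.range ((P k).natDegree + 1), Polynomial.monomial j (φ ((P k).coeff j))
  have hp : ∀ k j, (p k).coeff j = φ ((P k).coeff j) := by
    intro k j
    simp only [p, Polynomial.finsetSum_coeff, Polynomial.coeff_monomial, Finset.sum_ite_eq',
      Finset.mem_range]
    split_ifs with hj
    · rfl
    · rw [Polynomial.coeff_eq_zero_of_natDegree_lt (by omega), map_zero]
  have heval : ∀ k (n : ℕ), φ ((P k).eval (n : A)) = (p k).eval (n : K) := by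
    intro k n
    simp only [p, Polynomial.eval_eq_sum_range (p := P k), map_sum, Polynomial.eval_finsetSum,
      Polynomial.eval_monomial]
    refine Finset.sum_congr rfl fun j _ => ?_
    have : (P k).coeff j * (n : A) ^ j = (n : K) ^ j • (P k).coeff j := by
      rw [Algebra.smul_def, map_pow, map_natCast, mul_comm]
    rw [this, map_smul, smul_eq_mul, mul_comm]
  have hpk : p k = 0 := eq_zero_of_sum_pow_mul_eval_eq_zero hc hc0 p (fun n => by
    simpa [heval] using LinearMap.mem_ker.1 (hN (h n))) k
  exact hφ (by rw [← hp, hpk, Polynomial.coeff_zero])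

end ExponentialPolynomials

section WeylAlgebra

variable {K σ : Type*} [Field K]

theorem totalDegree_pderiv_lt {i : σ} {f : MvPolynomial σ K} (hf : f.totalDegree ≠ 0) :
    (pderiv i f).totalDegree < f.totalDegree := by
  rw [totalDegree, Finset.sup_lt_iff (by simpa using Nat.pos_of_ne_zero hf)]
  intro d hd
  have hmem : d + Finsupp.single i 1 ∈ f.support := by
    rw [mem_support_iff, coeff_pderiv] at hd
    exact mem_support_iff.2 (left_ne_zero_of_mul hd)
  have := le_totalDegree hmem
  rw [Finsupp.sum_add_index' (by simp) (by simp), Finsupp.sum_single_index rfl] at this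
  omega

theorem exists_pderiv_ne_zero [CharZero K] {f : MvPolynomial σ K} (hf : f.totalDegree ≠ 0) :
    ∃ i, pderiv i f ≠ 0 := by
  by_contra! h
  refine hf ((totalDegree_eq_zero_iff_eq_C).2 ?_)
  classical
  ext d
  rw [coeff_C]
  split_ifs with hd
  · rw [hd]
  · obtain ⟨i, hi⟩ := Finsupp.ne_iff.1 (Ne.symm hd)
    have := congrArg (coeff (d - Finsupp.single i 1)) (h i)
    rw [coeff_pderiv, tsub_add_cancel_of_le
      (Finsupp.single_le_iff.2 (Nat.one_le_iff_ne_zero.2 hi)), coeff_zero] at this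
    exact (mul_eq_zero.1 this).resolve_right (Nat.cast_add_one_ne_zero _)

/-- In characteristic zero the polynomial ring is simple over the Weyl algebra. -/
theorem eq_bot_or_eq_top_of_X_mul_mem_of_pderiv_mem [CharZero K]
    (N : Submodule K (MvPolynomial σ K)) (hX : ∀ i, ∀ f ∈ N, X i * f ∈ N)
    (hD : ∀ i, ∀ f ∈ N, pderiv i f ∈ N) : N = ⊥ ∨ N = ⊤ := by
  rw [or_iff_not_imp_left]
  intro hN
  obtain ⟨f, hfN, hf⟩ := N.exists_mem_ne_zero_of_ne_bot hN
  have hone : 1 ∈ N := by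
    induction hn : f.totalDegree using Nat.strong_induction_on generalizing f with
    | _ n ih =>
      by_cases h0 : f.totalDegree = 0
      · rw [totalDegree_eq_zero_iff_eq_C] at h0
        have hc : coeff 0 f ≠ 0 := fun hc => hf (by rw [h0, hc, C_0])
        have := N.smul_mem (coeff 0 f)⁻¹ hfN
        generalize coeff 0 f = c at *
        rwa [h0, smul_eq_C_mul, ← C_mul, inv_mul_cancel₀ hc, C_1] at this
      · obtain ⟨i, hi⟩ := exists_pderiv_ne_zero h0
        exact ih _ (hn ▸ totalDegree_pderiv_lt h0) _ (hD i f hfN) hi rfl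
  refine (Submodule.eq_top_iff').2 fun p => ?_
  induction p using MvPolynomial.induction_on with
  | C a => simpa [smul_eq_C_mul] using N.smul_mem a hone
  | add p q hp hq => exact N.add_mem hp hq
  | mul_X p i hp => rw [mul_comm]; exact hX i p hp

end WeylAlgebra

section Shift

/-- `shf k n` as an algebra homomorphism. -/
def shfHom (k : Fin m) (n : ℤ) : TT m →ₐ[ℂ] TT m :=
  aeval (Function.update (X : Fin m ⊕ Fin m → TT m) (Sum.inl k) (X (Sum.inl k) - C (n : ℂ)))

theorem shf_eq_shfHom (k : Fin m) (n : ℤ) (f : TT m) : shf k n f = shfHom k n f := rfl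

theorem shfHom_X_inl (k l : Fin m) (n : ℤ) :
    shfHom k n (X (Sum.inl l)) =
      if l = k then X (Sum.inl k) - C (n : ℂ) else X (Sum.inl l) := by
  simp [shfHom, Function.update_apply]

@[simp]
theorem shfHom_X_inr (k l : Fin m) (n : ℤ) :
    shfHom k n (X (Sum.inr l)) = X (Sum.inr l) := by
  simp [shfHom]

theorem shfHom_comm (k l : Fin m) (n p : ℤ) (f : TT m) :
    shfHom k n (shfHom l p f) = shfHom l p (shfHom k n f) := by
  suffices (shfHom k n).comp (shfHom l p) = (shfHom l p).comp (shfHom k n) from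
    DFunLike.congr_fun this f
  refine algHom_ext fun x => ?_
  rcases x with x | x
  · simp only [AlgHom.comp_apply, shfHom_X_inl]
    split_ifs <;> simp_all [shfHom_X_inl]
    ring
  · simp

theorem pderiv_inr_shf (k l : Fin m) (n : ℤ) (f : TT m) :
    pderiv (Sum.inr l) (shf k n f) = shf k n (pderiv (Sum.inr l) f) := by
  simp only [shf_eq_shfHom]
  induction f using MvPolynomial.induction_on with
  | C a => simp [algHom_C]
  | add p q hp hq => simp only [map_add, hp, hq]
  | mul_X p x hp =>
    simp only [map_mul, pderiv_mul, hp, map_add]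
    congr 2
    rcases x with x | x
    · rw [shfHom_X_inl]
      split_ifs <;> simp [pderiv_X]
    · by_cases h : x = l <;> simp [pderiv_X, h]

/-- `shf k n f` as a polynomial in `n`. -/
def shfPoly (k : Fin m) : TT m →ₐ[ℂ] Polynomial (TT m) :=
  aeval (Function.update (fun x => Polynomial.C (X x)) (Sum.inl k)
    (Polynomial.C (X (Sum.inl k)) - Polynomial.X))

theorem shfPoly_X (k : Fin m) (x : Fin m ⊕ Fin m) :
    shfPoly k (X x) = if x = Sum.inl k then Polynomial.C (X (Sum.inl k)) - Polynomial.X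
      else Polynomial.C (X x) := by
  simp [shfPoly, Function.update_apply]

theorem eval_shfPoly (k : Fin m) (n : ℕ) (f : TT m) :
    (shfPoly k f).eval (n : TT m) = shf k n f := by
  rw [shf_eq_shfHom]
  induction f using MvPolynomial.induction_on with
  | C a => simp [algHom_C]
  | add p q hp hq => simp only [map_add, Polynomial.eval_add, hp, hq]
  | mul_X p x hp =>
    rw [map_mul, map_mul, Polynomial.eval_mul, hp, shfPoly_X]
    rcases x with x | x
    · rw [shfHom_X_inl]
      by_cases h : x = k <;> simp [h]
    · simp

theorem coeff_zero_shfPoly (k : Fin m) (f : TT m) : (shfPoly k f).coeff 0 = f := by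
  induction f using MvPolynomial.induction_on with
  | C a => simp
  | add p q hp hq => simp only [map_add, Polynomial.coeff_add, hp, hq]
  | mul_X p x hp =>
    rw [map_mul, Polynomial.mul_coeff_zero, hp, shfPoly_X]
    split_ifs with h <;> simp [h]

theorem coeff_one_shfPoly (k : Fin m) (f : TT m) :
    (shfPoly k f).coeff 1 = -pderiv (Sum.inl k) f := by
  induction f using MvPolynomial.induction_on with
  | C a => simp
  | add p q hp hq => simp only [map_add, Polynomial.coeff_add, hp, hq, neg_add]
  | mul_X p x hp =>
    rw [map_mul, Polynomial.mul_coeff_one, hp, shfPoly_X, coeff_zero_shfPoly, pderiv_mul]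
    split_ifs with h
    · simp [h, Polynomial.coeff_C]
    · simp [pderiv_X_of_ne h, Polynomial.coeff_C]

/-- The polynomials on which shifting `s_i` and shifting `s_j` agree, that is, those depending on
`s_i` and `s_j` only through `s_i + s_j`. -/
def shfEqualizer (i j : Fin m) : Subalgebra ℂ (TT m) :=
  ⨅ n : ℤ, AlgHom.equalizer (shfHom i n) (shfHom j n)

theorem mem_shfEqualizer {i j : Fin m} {f : TT m} :
    f ∈ shfEqualizer i j ↔ ∀ n, shfHom i n f = shfHom j n f := by
  simp [shfEqualizer, Algebra.mem_iInf, AlgHom.mem_equalizer]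

variable {i j : Fin m}

theorem X_inr_mem_shfEqualizer (k : Fin m) : X (Sum.inr k) ∈ shfEqualizer i j :=
  mem_shfEqualizer.2 fun n => by simp

theorem X_inl_mem_shfEqualizer {k : Fin m} (hi : k ≠ i) (hj : k ≠ j) :
    X (Sum.inl k) ∈ shfEqualizer i j :=
  mem_shfEqualizer.2 fun n => by simp [shfHom_X_inl, hi, hj]

theorem X_add_X_mem_shfEqualizer (hij : i ≠ j) :
    X (Sum.inl i) + X (Sum.inl j) ∈ shfEqualizer i j :=
  mem_shfEqualizer.2 fun n => by
    simp only [map_add, shfHom_X_inl, hij, hij.symm, if_true, if_false]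
    ring

theorem X_inl_notMem_shfEqualizer (hij : i ≠ j) : X (Sum.inl i) ∉ shfEqualizer i j := by
  intro h
  have := mem_shfEqualizer.1 h 1
  simp [shfHom_X_inl, hij] at this

theorem C_mem_shfEqualizer (a : ℂ) : C a ∈ shfEqualizer i j :=
  (shfEqualizer i j).algebraMap_mem a

theorem gT_mem_shfEqualizer (g : Fin m → Polynomial ℂ) (k : Fin m) :
    gT g k ∈ shfEqualizer i j :=
  (Algebra.adjoin_singleton_le (X_inr_mem_shfEqualizer k))
    (Polynomial.aeval_mem_adjoin_singleton ℂ _)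

theorem shf_mem_shfEqualizer {f : TT m} (hf : f ∈ shfEqualizer i j) (k : Fin m) (n : ℤ) :
    shf k n f ∈ shfEqualizer i j :=
  mem_shfEqualizer.2 fun p => by
    rw [shf_eq_shfHom, shfHom_comm i, shfHom_comm j, mem_shfEqualizer.1 hf p]

theorem pderiv_inr_mem_shfEqualizer {f : TT m} (hf : f ∈ shfEqualizer i j) (k : Fin m) :
    pderiv (Sum.inr k) f ∈ shfEqualizer i j :=
  mem_shfEqualizer.2 fun p => by
    rw [← shf_eq_shfHom, ← shf_eq_shfHom, ← pderiv_inr_shf, ← pderiv_inr_shf, shf_eq_shfHom,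
      shf_eq_shfHom, mem_shfEqualizer.1 hf p]

theorem tL_mem_shfEqualizer (hij : i ≠ j) (α : Fin m → ℂ) {lam : Fin m → ℂ} (hlam : lam i = lam j)
    (n : ℤ) {f : TT m} (hf : f ∈ shfEqualizer i j) : tL α lam n f ∈ shfEqualizer i j := by
  have hj : j ∈ Finset.univ.erase i := Finset.mem_erase.2 ⟨hij.symm, Finset.mem_univ j⟩
  rw [tL, ← Finset.add_sum_erase _ _ (Finset.mem_univ i), ← Finset.add_sum_erase _ _ hj,
    ← add_assoc]
  refine add_mem ?_ (sum_mem fun k hk => ?_)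
  · have hshf : shf j n f = shf i n f := (mem_shfEqualizer.1 hf n).symm
    rw [hlam, hshf, ← smul_add, ← add_mul]
    refine Subalgebra.smul_mem _ (mul_mem ?_ (shf_mem_shfEqualizer hf i n)) _
    rw [add_add_add_comm]
    exact add_mem (X_add_X_mem_shfEqualizer hij)
      (add_mem (C_mem_shfEqualizer _) (C_mem_shfEqualizer _))
  · simp only [Finset.mem_erase] at hk
    exact Subalgebra.smul_mem _ (mul_mem (add_mem (X_inl_mem_shfEqualizer hk.2.1 hk.1)
      (C_mem_shfEqualizer _)) (shf_mem_shfEqualizer hf k n)) _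

end Shift

theorem tensor_simple_iff_lambda_distinct
    (m : ℕ) (α β γ lam : Fin m → ℂ) (g : Fin m → Polynomial ℂ)
    (hβ : ∀ k, β k ≠ 0) (hlam : ∀ k, lam k ≠ 0) :
    (∀ N : Submodule ℂ (TT m),
        (∀ (n : ℤ), ∀ f ∈ N, tL α lam n f ∈ N ∧ tD β γ lam g n f ∈ N ∧
          tA lam n f ∈ N ∧ tB β lam g n f ∈ N ∧ tC β lam n f ∈ N) →
        N = ⊥ ∨ N = ⊤)
      ↔ Function.Injective lam := by
  constructor
  · intro H
    by_contra hinj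
    obtain ⟨i, j, hlij, hij⟩ : ∃ i j, lam i = lam j ∧ i ≠ j := by
      simpa [Function.Injective] using hinj
    rcases H (shfEqualizer i j).toSubmodule fun n f hf => ⟨tL_mem_shfEqualizer hij α hlij n hf,
      sum_mem fun k _ => add_mem
        (Subalgebra.smul_mem _ (mul_mem (add_mem (mul_mem (X_inr_mem_shfEqualizer k)
          (gT_mem_shfEqualizer g k)) (C_mem_shfEqualizer _)) (shf_mem_shfEqualizer hf k n)) _)
        (Subalgebra.smul_mem _ (mul_mem (X_inr_mem_shfEqualizer k)
          (pderiv_inr_mem_shfEqualizer (shf_mem_shfEqualizer hf k n) k)) _),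
      sum_mem fun k _ => Subalgebra.smul_mem _
        (mul_mem (X_inr_mem_shfEqualizer k) (shf_mem_shfEqualizer hf k n)) _,
      sum_mem fun k _ => add_mem
        (Subalgebra.smul_mem _ (mul_mem (gT_mem_shfEqualizer g k)
          (shf_mem_shfEqualizer hf k n)) _)
        (Subalgebra.smul_mem _
          (pderiv_inr_mem_shfEqualizer (shf_mem_shfEqualizer hf k n) k) _),
      sum_mem fun k _ => Subalgebra.smul_mem _ (shf_mem_shfEqualizer hf k n) _⟩ with h | h
    · exact one_ne_zero ((Submodule.eq_bot_iff _).1 h 1 (one_mem (shfEqualizer i j)))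
    · exact X_inl_notMem_shfEqualizer hij
        (show X (Sum.inl i) ∈ (shfEqualizer i j).toSubmodule from h ▸ Submodule.mem_top)
  · intro hinj N hN
    have hcoeff : ∀ P : Fin m → Polynomial (TT m),
        (∀ n : ℕ, ∑ k, lam k ^ n • (P k).eval (n : TT m) ∈ N) → ∀ k j, (P k).coeff j ∈ N :=
      coeff_mem_of_sum_pow_smul_eval_mem N hinj hlam
    have hA : ∀ f ∈ N, ∀ k, X (Sum.inr k) * f ∈ N := fun f hf k => by
      have := hcoeff (fun k => Polynomial.C (X (Sum.inr k)) * shfPoly k f)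
        (fun n => by
          simpa only [Polynomial.eval_mul, Polynomial.eval_C, eval_shfPoly, tA, zpow_natCast]
            using (hN n f hf).2.2.1) k 0
      rwa [Polynomial.coeff_C_mul, coeff_zero_shfPoly] at this
    have hL : ∀ f ∈ N, ∀ k, X (Sum.inl k) * f ∈ N := fun f hf k => by
      have := hcoeff (fun k => (Polynomial.C (X (Sum.inl k)) +
          Polynomial.X * Polynomial.C (C (α k))) * shfPoly k f)
        (fun n => by
          simpa only [Polynomial.eval_mul, Polynomial.eval_add, Polynomial.eval_C,
            Polynomial.eval_X, eval_shfPoly, tL, zpow_natCast, Int.cast_natCast, C_mul,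
            map_natCast] using (hN n f hf).1) k 0
      rwa [Polynomial.mul_coeff_zero, Polynomial.coeff_add, Polynomial.coeff_C_zero,
        Polynomial.mul_coeff_zero, Polynomial.coeff_X_zero, zero_mul, add_zero,
        coeff_zero_shfPoly] at this
    have hC : ∀ f ∈ N, ∀ k, pderiv (Sum.inl k) f ∈ N := fun f hf k => by
      have := hcoeff (fun k => Polynomial.C (C (-β k)) * shfPoly k f)
        (fun n => by
          simpa only [Polynomial.eval_mul, Polynomial.eval_C, eval_shfPoly, tC, zpow_natCast,
            ← smul_eq_C_mul, smul_smul, neg_mul, mul_neg] using (hN n f hf).2.2.2.2) k 1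
      rw [Polynomial.coeff_C_mul, coeff_one_shfPoly, ← smul_eq_C_mul, neg_smul_neg] at this
      exact (N.smul_mem_iff (hβ k)).1 this
    have hg : ∀ f ∈ N, ∀ k, gT g k * f ∈ N := fun f hf k => by
      rw [gT]
      induction g k using Polynomial.induction_on' with
      | add p q hp hq => rw [map_add, add_mul]; exact N.add_mem hp hq
      | monomial r a =>
        rw [Polynomial.aeval_monomial, mul_assoc, ← Algebra.smul_def]
        refine N.smul_mem _ ?_
        induction r with
        | zero => simpa using hf
        | succ r ih => rw [pow_succ', mul_assoc]; exact hA _ ih k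
    have hB : ∀ f ∈ N, ∀ k, pderiv (Sum.inr k) f ∈ N := fun f hf k => by
      have := hcoeff (fun k => Polynomial.C (gT g k) * shfPoly k f +
          Polynomial.C (C (β k)) * shfPoly k (pderiv (Sum.inr k) f))
        (fun n => by
          simpa only [Polynomial.eval_add, Polynomial.eval_mul, Polynomial.eval_C, eval_shfPoly,
            tB, pderiv_inr_shf, zpow_natCast, ← smul_eq_C_mul, smul_smul, smul_add] using
            (hN n f hf).2.2.2.1) k 0
      rw [Polynomial.coeff_add, Polynomial.coeff_C_mul, Polynomial.coeff_C_mul,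
        coeff_zero_shfPoly, coeff_zero_shfPoly, ← smul_eq_C_mul] at this
      exact (N.smul_mem_iff (hβ k)).1 ((N.add_mem_iff_right (hg f hf k)).1 this)
    exact eq_bot_or_eq_top_of_X_mul_mem_of_pderiv_mem N
      (fun x f hf => x.rec (hL f hf) (hA f hf)) (fun x f hf => x.rec (hC f hf) (hB f hf))

end
end
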